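/- arXiv:2010.06832 — 5 statements merged into one kernel-verified Lean document; each statement's English description precedes it below -/
import Mathlib

section
/- For all natural numbers n ≥ 1 and k ≥ 1, the following binomial identity holds: ∑_{j=0}^{2n} C(2n, j) · ( ∑_{p=1}^{min(k,j)} 2^p · C(j,p) · C(k−1, p−1) ) = 2^{2n} · C(2n+k−1, k), where an inner sum over an empty range equals 0. -/
theorem sum_choose_mul_choose_mul_two_pow (m p : ℕ) :
    ∑ j ∈ Finset.range (m + 1), m.choose j * (2 ^ p * j.choose p) = 2 ^ m * m.choose p := by
  rcases lt_or_ge m p with h | h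
  · rw [Nat.choose_eq_zero_of_lt h, mul_zero]
    refine Finset.sum_eq_zero fun j hj => ?_
    rw [Nat.choose_eq_zero_of_lt (n := j) (by simp at hj; omega), mul_zero, mul_zero]
  · obtain ⟨d, rfl⟩ := Nat.exists_eq_add_of_le h
    rw [add_assoc, Finset.sum_range_add, Finset.sum_eq_zero, zero_add]
    · calc ∑ i ∈ Finset.range (d + 1), (p + d).choose (p + i) * (2 ^ p * (p + i).choose p)
          = ∑ i ∈ Finset.range (d + 1), 2 ^ p * (p + d).choose p * d.choose i := by
            refine Finset.sum_congr rfl fun i _ => ?_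
            have := Nat.choose_mul (n := p + d) (k := p + i) (s := p) (by omega)
            simp only [Nat.add_sub_cancel_left] at this
            rw [mul_left_comm, this, mul_assoc]
        _ = 2 ^ (p + d) * (p + d).choose p := by
            rw [← Finset.mul_sum, Nat.sum_range_choose]
            ring
    · intro j hj
      rw [Nat.choose_eq_zero_of_lt (n := j) (by simpa using hj), mul_zero, mul_zero]

theorem sum_choose_succ_mul_choose (m q : ℕ) :
    ∑ i ∈ Finset.range (q + 1), m.choose (i + 1) * q.choose i = (m + q).choose (q + 1) := by
  rw [Nat.add_choose_eq,
    Finset.Nat.sum_antidiagonal_eq_sum_range_succ (fun a b => m.choose a * q.choose b),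
    Finset.sum_range_succ' _ (q + 1)]
  simp only [Nat.add_sub_add_right, Nat.sub_zero, Nat.choose_succ_self, mul_zero, add_zero]
  refine Finset.sum_congr rfl fun i hi => ?_
  rw [Nat.choose_symm (Nat.le_of_lt_succ (Finset.mem_range.mp hi))]

/-- For all natural numbers `n ≥ 1` and `k ≥ 1`:
`∑_{j=0}^{2n} C(2n, j) · ( ∑_{p=1}^{min(k,j)} 2^p · C(j,p) · C(k−1, p−1) )
  = 2^{2n} · C(2n+k−1, k)`. -/
theorem binomial_identity_sum_over_genus (n k : ℕ) (hn : 1 ≤ n) (hk : 1 ≤ k) :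
    ∑ j ∈ Finset.range (2 * n + 1),
      Nat.choose (2 * n) j *
        ∑ p ∈ Finset.Icc 1 (min k j),
          2 ^ p * Nat.choose j p * Nat.choose (k - 1) (p - 1) =
      2 ^ (2 * n) * Nat.choose (2 * n + k - 1) k := by
  obtain ⟨q, rfl⟩ := Nat.exists_eq_add_of_le' hk
  have inner (j : ℕ) : ∑ p ∈ Finset.Icc 1 (min (q + 1) j),
      2 ^ p * Nat.choose j p * Nat.choose (q + 1 - 1) (p - 1) =
      ∑ i ∈ Finset.range (q + 1), 2 ^ (i + 1) * j.choose (i + 1) * q.choose i := by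
    have extend : ∑ p ∈ Finset.Icc 1 (min (q + 1) j),
        2 ^ p * Nat.choose j p * Nat.choose (q + 1 - 1) (p - 1) =
        ∑ p ∈ Finset.Ico 1 (q + 2),
          2 ^ p * Nat.choose j p * Nat.choose (q + 1 - 1) (p - 1) := by
      refine Finset.sum_subset (fun p hp => ?_) fun p hp hp' => ?_
      · simp only [Finset.mem_Icc, Finset.mem_Ico] at hp ⊢
        omega
      · simp only [Finset.mem_Icc, Finset.mem_Ico] at hp hp'
        rw [Nat.choose_eq_zero_of_lt (n := j) (by omega), mul_zero, zero_mul]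
    rw [extend, Finset.sum_Ico_eq_sum_range]
    refine Finset.sum_congr rfl fun i _ => ?_
    simp only [Nat.add_sub_cancel, add_comm 1 i]
  simp only [inner, Finset.mul_sum]
  rw [Finset.sum_comm, ← Nat.add_assoc, Nat.add_sub_cancel, ← sum_choose_succ_mul_choose,
    Finset.mul_sum]
  refine Finset.sum_congr rfl fun i _ => ?_
  rw [← mul_assoc, ← sum_choose_mul_choose_mul_two_pow, Finset.sum_mul]
  exact Finset.sum_congr rfl fun j _ => (mul_assoc _ _ _).symm
end

section
/- Fix natural numbers n ≥ 1, k ≥ 1, and j with 0 ≤ j ≤ 2n. The number of type-(2n+1) tuples (ε, c) such that exactly j of the entries c_1, …, c_{2n} are nonzero and c̄_1 + c̄_2 + ⋯ + c̄_{2n} = k is equal to C(2n, j) · ( ∑_{p=1}^{min(k,j)} 2^p · C(j,p) · C(k−1, p−1) ), where a sum over an empty range equals 0 (in particular the count is 0 when j = 0). -/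
/-- A type-(2n+1) tuple: `ε = (ε_1, …, ε_{2n+1})` (0-indexed here) with every
`ε_i ∈ {1, −1}` and `ε_1 = 1`, together with integers `c = (c_1, …, c_{2n})`,
subject to the normalization that `c_i = 0` implies `ε_i = ε_{i+1}`. -/
structure TypeTuple (n : ℕ) where
  eps : Fin (2 * n + 1) → ℤ
  c : Fin (2 * n) → ℤ
  eps_pm : ∀ i, eps i = 1 ∨ eps i = -1
  eps_zero : eps 0 = 1
  norm : ∀ i : Fin (2 * n), c i = 0 → eps i.castSucc = eps i.succ

/-- `ψ(i) = 1` if `ε_i · c_i < 0` and `0` otherwise. -/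
def TypeTuple.psi {n : ℕ} (T : TypeTuple n) (i : Fin (2 * n)) : ℕ :=
  if T.eps i.castSucc * T.c i < 0 then 1 else 0

/-- `ψ̄(i) = 1` if `c_i · ε_{i+1} < 0` and `0` otherwise. -/
def TypeTuple.psiBar {n : ℕ} (T : TypeTuple n) (i : Fin (2 * n)) : ℕ :=
  if T.c i * T.eps i.succ < 0 then 1 else 0

/-- `c̄_i = 2|c_i| − ψ(i) − ψ̄(i)` (a nonnegative integer). -/
def TypeTuple.cbar {n : ℕ} (T : TypeTuple n) (i : Fin (2 * n)) : ℕ :=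
  2 * (T.c i).natAbs - T.psi i - T.psiBar i

/-- A type-(2n+1) tuple is symmetric if `ε_i = ε_{2n+2−i}` and `c_i = c_{2n+1−i}`. -/
def TypeTuple.Symm {n : ℕ} (T : TypeTuple n) : Prop :=
  (∀ i, T.eps i = T.eps i.rev) ∧ (∀ i, T.c i = T.c i.rev)

open Finset

/-- The number of functions on `s` with sum `n`, extended by zero outside `s`. -/
lemma card_piAntidiag_nat {ι : Type*} [DecidableEq ι] (s : Finset ι) (n : ℕ) :
    #(piAntidiag s n) = (#s + n - 1).choose n := by
  rw [← card_finsuppAntidiag_nat_eq_choose, finsuppAntidiag, card_map, card_attach]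

/-- The number of compositions of `k` with parts indexed by `P`. -/
lemma card_piAntidiag_filter_support_eq {ι : Type*} [DecidableEq ι] {S P : Finset ι}
    (hP : P ⊆ S) {k : ℕ} (hk : 1 ≤ k) :
    #{h ∈ piAntidiag S k | {i ∈ S | h i ≠ 0} = P} =
      if #P ∈ Icc 1 k then (k - 1).choose (#P - 1) else 0 := by
  have sum_eq : ∀ h ∈ ({h ∈ piAntidiag S k | {i ∈ S | h i ≠ 0} = P} : Finset (ι → ℕ)),
      ∑ i ∈ P, h i = k ∧ ∀ i, h i ≠ 0 ↔ i ∈ P := by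
    intro h hh
    rw [mem_filter, mem_piAntidiag] at hh
    obtain ⟨⟨hs, hS⟩, rfl⟩ := hh
    refine ⟨by rw [sum_filter_ne_zero, hs], fun i ↦ ?_⟩
    rw [mem_filter]
    exact ⟨fun hi ↦ ⟨hS i hi, hi⟩, And.right⟩
  split_ifs with hp
  · rw [mem_Icc] at hp
    have key : #{h ∈ piAntidiag S k | {i ∈ S | h i ≠ 0} = P} = #(piAntidiag P (k - #P)) := by
      refine card_nbij' (fun h i ↦ h i - 1) (fun g i ↦ if i ∈ P then g i + 1 else 0) ?_ ?_ ?_ ?_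
      · intro h hh
        obtain ⟨hs, hS⟩ := sum_eq h hh
        rw [mem_coe, mem_piAntidiag]
        refine ⟨?_, fun i hi ↦ (hS i).1 fun h0 ↦ hi (by simp [h0])⟩
        rw [sum_tsub_distrib _ fun i hi ↦ Nat.one_le_iff_ne_zero.2 ((hS i).2 hi), hs]
        simp
      · intro g hg
        rw [mem_coe, mem_piAntidiag] at hg
        rw [mem_coe, mem_filter, mem_piAntidiag]
        refine ⟨⟨?_, fun i hi ↦ ?_⟩, ?_⟩
        · rw [← sum_filter, filter_mem_eq_inter, inter_eq_right.2 hP, sum_add_distrib, hg.1]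
          simp
          omega
        · by_contra hS
          exact hi (if_neg fun h ↦ hS (hP h))
        · ext i
          have := @hP i
          by_cases hi : i ∈ P <;> simp_all
      · intro h hh
        ext i
        have := (sum_eq h hh).2 i
        by_cases hi : i ∈ P <;> simp only [hi, if_true, if_false, iff_true, iff_false] at this ⊢ <;>
          omega
      · intro g hg
        rw [mem_coe, mem_piAntidiag] at hg
        ext i
        have := hg.2 i
        by_cases hi : i ∈ P <;> simp only [hi, if_true, if_false] <;> grind
    rw [key, card_piAntidiag_nat, show #P + (k - #P) - 1 = k - 1 by omega]
    exact Nat.choose_symm_of_eq_add (by omega)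
  · rw [card_eq_zero, eq_empty_iff_forall_notMem]
    intro h hh
    obtain ⟨hs, hS⟩ := sum_eq h hh
    refine hp (mem_Icc.2 ⟨?_, ?_⟩)
    · by_contra hP0
      rw [card_eq_zero.1 (by omega : #P = 0), sum_empty] at hs
      omega
    · rw [← hs, card_eq_sum_ones]
      exact sum_le_sum fun i hi ↦ Nat.one_le_iff_ne_zero.2 ((hS i).2 hi)

lemma sum_piAntidiag_two_pow {ι : Type*} [DecidableEq ι] (S : Finset ι) {k : ℕ} (hk : 1 ≤ k) :
    ∑ h ∈ piAntidiag S k, 2 ^ #{i ∈ S | h i ≠ 0} =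
      ∑ p ∈ Icc 1 (min k #S), 2 ^ p * (#S).choose p * (k - 1).choose (p - 1) := by
  have maps_to : ∀ h ∈ piAntidiag S k, {i ∈ S | h i ≠ 0} ∈ S.powerset :=
    fun h _ ↦ mem_powerset.2 (filter_subset _ S)
  rw [← sum_fiberwise_of_maps_to' maps_to fun P ↦ 2 ^ #P]
  set f : ℕ → ℕ := fun p ↦ (if p ∈ Icc 1 k then (k - 1).choose (p - 1) else 0) * 2 ^ p
  calc _ = ∑ P ∈ S.powerset, f #P := sum_congr rfl fun P hP ↦ by
        rw [sum_const, card_piAntidiag_filter_support_eq (mem_powerset.1 hP) hk, smul_eq_mul]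
    _ = ∑ p ∈ range (#S + 1), (#S).choose p • f p := sum_powerset_apply_card f
    _ = _ := by
      rw [← sum_subset (s₁ := Icc 1 (min k #S))]
      · refine sum_congr rfl fun p hp ↦ ?_
        simp only [mem_Icc, le_min_iff] at hp
        dsimp only [f]
        rw [if_pos (mem_Icc.2 ⟨hp.1, hp.2.1⟩), smul_eq_mul]
        ring
      · intro p hp
        simp only [mem_Icc, le_min_iff] at hp
        exact mem_range.2 (by omega)
      · intro p hp hp'
        dsimp only [f]
        rw [if_neg, zero_mul, smul_zero]
        simp only [mem_range, mem_Icc, le_min_iff] at hp hp' ⊢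
        omega

/-- The codes of absolute value `v`, or only `none` if `b` fails. -/
def optionIntOfNatAbs (b : Prop) [Decidable b] (v : ℕ) : Finset (Option ℤ) :=
  if b then {some (v : ℤ), some (-(v : ℤ))} else {none}

lemma mem_optionIntOfNatAbs {b : Prop} [Decidable b] {v : ℕ} (hv : ¬ b → v = 0) {o : Option ℤ} :
    o ∈ optionIntOfNatAbs b v ↔ (o ≠ none ↔ b) ∧ o.elim 0 Int.natAbs = v := by
  by_cases hb : b <;> cases o <;> simp [optionIntOfNatAbs, hb, Int.natAbs_eq_iff]; grind

lemma card_optionIntOfNatAbs {b : Prop} [Decidable b] {v : ℕ} (hv : ¬ b → v = 0) :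
    #(optionIntOfNatAbs b v) = if v ≠ 0 then 2 else 1 := by
  by_cases hb : b
  · by_cases h : v = 0
    · simp [optionIntOfNatAbs, hb, h]
    · simp only [optionIntOfNatAbs, hb, if_true, ne_eq, h, not_false_eq_true]
      exact card_pair (by simp; omega)
  · simp [optionIntOfNatAbs, hb, hv hb]

/-- The number of functions to `Option ℤ` that are defined at `j` points and whose absolute values
sum to `k`. -/
lemma card_optionInt_functions {ι : Type*} [Fintype ι] [DecidableEq ι] {k : ℕ} (hk : 1 ≤ k)
    (j : ℕ) :
    Nat.card {f : ι → Option ℤ //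
        #{i | f i ≠ none} = j ∧ ∑ i, (f i).elim 0 Int.natAbs = k} =
      (Fintype.card ι).choose j *
        ∑ p ∈ Icc 1 (min k j), 2 ^ p * j.choose p * (k - 1).choose (p - 1) := by
  set I := (powersetCard j (univ : Finset ι)).sigma fun S ↦ piAntidiag S k
  have zero_of_notMem : ∀ x ∈ I, ∀ i, i ∉ x.1 → x.2 i = 0 := by
    intro x hx i hi
    by_contra h
    exact hi ((mem_piAntidiag.1 (mem_sigma.1 hx).2).2 i h)
  have mem_piFinset : ∀ x ∈ I, ∀ f,
      f ∈ Fintype.piFinset (fun i ↦ optionIntOfNatAbs (i ∈ x.1) (x.2 i)) ↔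
        x = ⟨({i | f i ≠ none} : Finset ι), fun i ↦ (f i).elim 0 Int.natAbs⟩ := by
    intro x hx f
    rw [Fintype.mem_piFinset,
      forall_congr' fun i ↦ mem_optionIntOfNatAbs (zero_of_notMem x hx i), forall_and]
    obtain ⟨S, h⟩ := x
    rw [Sigma.mk.injEq, heq_eq_eq, funext_iff, Finset.ext_iff]
    simp only [mem_filter_univ]
    exact and_congr (forall_congr' fun i ↦ Iff.comm) (forall_congr' fun i ↦ eq_comm)
  have set_eq : {f : ι → Option ℤ | #{i | f i ≠ none} = j ∧ ∑ i, (f i).elim 0 Int.natAbs = k} =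
      (I.biUnion fun x ↦ Fintype.piFinset fun i ↦ optionIntOfNatAbs (i ∈ x.1) (x.2 i) :
        Finset (ι → Option ℤ)) := by
    ext f
    have sum_filter_eq : ∑ i with f i ≠ none, (f i).elim 0 Int.natAbs =
        ∑ i, (f i).elim 0 Int.natAbs :=
      sum_filter_of_ne fun i _ hi h ↦ hi (by rw [h, Option.elim_none])
    rw [Set.mem_ofPred_eq, mem_coe, mem_biUnion]
    constructor
    · rintro ⟨hj, hs⟩
      have hx : (⟨({i | f i ≠ none} : Finset ι), fun i ↦ (f i).elim 0 Int.natAbs⟩ :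
          Σ _ : Finset ι, ι → ℕ) ∈ I := by
        refine mem_sigma.2 ⟨mem_powersetCard.2 ⟨subset_univ _, hj⟩, mem_piAntidiag.2
          ⟨sum_filter_eq.trans hs, fun i hi ↦ mem_filter.2 ⟨mem_univ i, fun h ↦ hi ?_⟩⟩⟩
        simp only [h, Option.elim_none]
      exact ⟨_, hx, (mem_piFinset _ hx f).2 rfl⟩
    · rintro ⟨x, hx, hf⟩
      obtain rfl := (mem_piFinset x hx f).1 hf
      have h := mem_sigma.1 hx
      exact ⟨(mem_powersetCard.1 h.1).2, sum_filter_eq.symm.trans (mem_piAntidiag.1 h.2).1⟩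
  have card_piFinset : ∀ x ∈ I,
      #(Fintype.piFinset fun i ↦ optionIntOfNatAbs (i ∈ x.1) (x.2 i)) =
        2 ^ #{i ∈ x.1 | x.2 i ≠ 0} := by
    intro x hx
    rw [Fintype.card_piFinset,
      prod_congr rfl fun i _ ↦ card_optionIntOfNatAbs (zero_of_notMem x hx i), ← prod_filter,
      prod_const]
    congr 2
    ext i
    have := zero_of_notMem x hx i
    simp only [mem_filter, mem_univ, true_and]
    tauto
  change Nat.card ({f : ι → Option ℤ | _} : Set _) = _
  rw [set_eq, Nat.card_eq_card_toFinset, toFinset_coe, card_biUnion, sum_congr rfl card_piFinset,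
    sum_sigma]
  · rw [sum_congr rfl fun S hS ↦ (sum_piAntidiag_two_pow S hk).trans
      (by rw [(mem_powersetCard.1 hS).2]), sum_const, card_powersetCard, card_univ, smul_eq_mul]
  · intro x hx y hy hxy
    rw [Function.onFun, disjoint_left]
    intro f hf hf'
    exact hxy (((mem_piFinset x hx f).1 hf).trans ((mem_piFinset y hy f).1 hf').symm)

/-- The code of an entry `c` standing between the signs `ε` and `δ`: it is `none` if `c = 0`, and
otherwise an integer whose absolute value is `2|c| − ψ − ψ̄` and whose parity tells whether the
sign changes. -/
def entryCode (ε c δ : ℤ) : Option ℤ :=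
  if c = 0 then none
  else some (2 * (ε * c) - (if δ = ε then 0 else 1) + if ε * c < 0 then 2 else 0)

/-- The factor by which the sign changes at an entry with code `o`. -/
def codeSign (o : Option ℤ) : ℤ := o.elim 1 fun z ↦ if z % 2 = 0 then 1 else -1

/-- The entry with code `o` standing after the sign `1`. -/
def codeEntry (o : Option ℤ) : ℤ := o.elim 0 fun z ↦ if 0 < z then (z + 1) / 2 else (z - 1) / 2

lemma codeSign_eq_or (o : Option ℤ) : codeSign o = 1 ∨ codeSign o = -1 := by
  cases o with
  | none => simp [codeSign]
  | some z => simp only [codeSign, Option.elim_some]; split_ifs <;> simp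

lemma entryCode_eq_none {ε c δ : ℤ} : entryCode ε c δ = none ↔ c = 0 := by
  simp [entryCode]

lemma eq_of_codeSign_of_codeEntry {ε c δ : ℤ} {o : Option ℤ} (hδ : δ = ε * codeSign o)
    (hc : c = ε * codeEntry o) (h : c = 0) (hε : ε = 1 ∨ ε = -1) : ε = δ := by
  cases o with
  | none => simp [hδ, codeSign]
  | some z =>
    simp only [codeSign, codeEntry, Option.elim_some] at hδ hc
    rcases hε with rfl | rfl <;> split_ifs at hδ hc <;> omega

lemma entryCode_eq_iff {ε c δ : ℤ} {o : Option ℤ} (hε : ε = 1 ∨ ε = -1) (hδ : δ = 1 ∨ δ = -1)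
    (h : c = 0 → ε = δ) :
    entryCode ε c δ = o ↔ δ = ε * codeSign o ∧ c = ε * codeEntry o := by
  cases o with
  | none =>
    simp only [entryCode_eq_none, codeSign, codeEntry, Option.elim_none, mul_one, mul_zero]
    exact ⟨fun hc ↦ ⟨(h hc).symm, hc⟩, And.right⟩
  | some z =>
    simp only [entryCode, codeSign, codeEntry, Option.elim_some]
    rcases hε with rfl | rfl <;> rcases hδ with rfl | rfl <;> grind

/-- The sequence of codes of the entries of a type-`(2n+1)` tuple. -/
def TypeTuple.codes {n : ℕ} (T : TypeTuple n) (i : Fin (2 * n)) : Option ℤ :=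
  entryCode (T.eps i.castSucc) (T.c i) (T.eps i.succ)

lemma TypeTuple.codes_eq_iff {n : ℕ} {T : TypeTuple n} {i : Fin (2 * n)} {o : Option ℤ} :
    T.codes i = o ↔ T.eps i.succ = T.eps i.castSucc * codeSign o ∧
      T.c i = T.eps i.castSucc * codeEntry o :=
  entryCode_eq_iff (T.eps_pm _) (T.eps_pm _) (T.norm i)

lemma TypeTuple.codes_eq_none {n : ℕ} {T : TypeTuple n} {i : Fin (2 * n)} :
    T.codes i = none ↔ T.c i = 0 :=
  entryCode_eq_none

lemma TypeTuple.elim_codes {n : ℕ} (T : TypeTuple n) (i : Fin (2 * n)) :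
    (T.codes i).elim 0 Int.natAbs = T.cbar i := by
  have h := T.norm i
  unfold codes entryCode cbar psi psiBar
  split_ifs with hc <;>
    rcases T.eps_pm i.castSucc with h1 | h1 <;> rcases T.eps_pm i.succ with h2 | h2 <;>
    simp only [h1, h2, Option.elim_some, Option.elim_none] at * <;> grind

lemma TypeTuple.codes_bijective (n : ℕ) : Function.Bijective (codes (n := n)) := by
  constructor
  · intro T T' h
    have hT (i) := codes_eq_iff.1 (congrFun h i)
    have hT' (i) := (codes_eq_iff (T := T') (i := i)).1 rfl
    have heps : T.eps = T'.eps := by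
      ext i
      induction i using Fin.induction with
      | zero => rw [T.eps_zero, T'.eps_zero]
      | succ i ih => rw [(hT i).1, (hT' i).1, ih]
    have hc : T.c = T'.c := by
      ext i
      rw [(hT i).2, (hT' i).2, heps]
    cases T
    cases T'
    simp_all
  · intro f
    set eps : Fin (2 * n + 1) → ℤ := Fin.partialProd fun i ↦ codeSign (f i)
    have eps_succ (i : Fin (2 * n)) : eps i.succ = eps i.castSucc * codeSign (f i) :=
      Fin.partialProd_succ _ i
    have eps_zero : eps 0 = 1 := Fin.partialProd_zero _
    have eps_pm (i) : eps i = 1 ∨ eps i = -1 := by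
      induction i using Fin.induction with
      | zero => exact Or.inl eps_zero
      | succ i ih =>
        rw [eps_succ]
        rcases ih with h | h <;> rcases codeSign_eq_or (f i) with h' | h' <;> simp [h, h']
    refine ⟨⟨eps, fun i ↦ eps i.castSucc * codeEntry (f i), eps_pm, eps_zero, fun i hi ↦
      eq_of_codeSign_of_codeEntry (eps_succ i) rfl hi (eps_pm _)⟩, funext fun i ↦ ?_⟩
    exact codes_eq_iff.2 ⟨eps_succ i, rfl⟩

/-- The number of type-(2n+1) tuples with exactly `j` nonzero `c_i` and
`∑ c̄_i = k` equals `C(2n, j) · ∑_{p=1}^{min(k,j)} 2^p C(j,p) C(k−1,p−1)`. -/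
theorem count_type_tuples_by_support_and_sum (n k j : ℕ) (hn : 1 ≤ n) (hk : 1 ≤ k)
    (hj : j ≤ 2 * n) :
    Nat.card {T : TypeTuple n //
        (Finset.univ.filter (fun i => T.c i ≠ 0)).card = j ∧ ∑ i, T.cbar i = k} =
      Nat.choose (2 * n) j *
        ∑ p ∈ Finset.Icc 1 (min k j),
          2 ^ p * Nat.choose j p * Nat.choose (k - 1) (p - 1) := by
  rw [Nat.card_congr ((Equiv.ofBijective _ (TypeTuple.codes_bijective n)).subtypeEquiv
    (q := fun f ↦ #{i | f i ≠ none} = j ∧ ∑ i, (f i).elim 0 Int.natAbs = k) fun T ↦ ?_),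
    card_optionInt_functions hk, Fintype.card_fin]
  simp only [Equiv.ofBijective_apply, T.elim_codes, ne_eq, TypeTuple.codes_eq_none]
end

section
/- Fix natural numbers n ≥ 1 and j with 0 ≤ j ≤ 2n. The number of type-(2n+1) tuples (ε, c) such that exactly j of the entries c_1, …, c_{2n} are nonzero and c̄_1 + c̄_2 + ⋯ + c̄_{2n} = 0 is equal to C(2n, j). -/
namespace TypeTuple

variable {n : ℕ}

theorem cbar_eq_zero (T : TypeTuple n) {i : Fin (2 * n)} (h : T.cbar i = 0) :
    T.eps i.succ = T.eps i.castSucc ∧ (T.c i = 0 ∨ T.c i = -T.eps i.castSucc) := by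
  by_cases hc : T.c i = 0
  · exact ⟨(T.norm i hc).symm, Or.inl hc⟩
  · unfold cbar psi psiBar at h
    rcases T.eps_pm i.castSucc with h1 | h1 <;> rcases T.eps_pm i.succ with h2 | h2 <;>
      rw [h1, h2] at h ⊢ <;> split_ifs at h <;> refine ⟨?_, Or.inr ?_⟩ <;> omega

theorem eps_eq_one (T : TypeTuple n) (h : ∀ i, T.cbar i = 0) (i : Fin (2 * n + 1)) :
    T.eps i = 1 := by
  induction i using Fin.induction with
  | zero => exact T.eps_zero
  | succ i ih => rw [(T.cbar_eq_zero (h i)).1, ih]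

theorem c_eq_ite (T : TypeTuple n) (h : ∀ i, T.cbar i = 0) (i : Fin (2 * n)) :
    T.c i = if T.c i ≠ 0 then -1 else 0 := by
  have := (T.cbar_eq_zero (h i)).2
  rw [T.eps_eq_one h] at this
  split_ifs <;> omega

/-- The tuple with all `ε_i = 1`, and `c_i = -1` exactly for `i ∈ s`. -/
def ofFinset (s : Finset (Fin (2 * n))) : TypeTuple n where
  eps _ := 1
  c i := if i ∈ s then -1 else 0
  eps_pm _ := Or.inl rfl
  eps_zero := rfl
  norm _ _ := rfl

theorem cbar_ofFinset (s : Finset (Fin (2 * n))) (i : Fin (2 * n)) :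
    (ofFinset s).cbar i = 0 := by
  by_cases h : i ∈ s <;> simp [ofFinset, cbar, psi, psiBar, h]

theorem filter_c_ofFinset (s : Finset (Fin (2 * n))) :
    Finset.univ.filter (fun i => (ofFinset s).c i ≠ 0) = s := by
  ext i
  simp [ofFinset]

theorem ofFinset_filter_c (T : TypeTuple n) (h : ∀ i, T.cbar i = 0) :
    ofFinset (Finset.univ.filter (fun i => T.c i ≠ 0)) = T := by
  have he := T.eps_eq_one h
  have hc := T.c_eq_ite h
  obtain ⟨eps, c, _, _, _⟩ := T
  simp only [ofFinset, mk.injEq]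
  refine ⟨funext fun i => (he i).symm, funext fun i => ?_⟩
  simpa using (hc i).symm

/-- Tuples with `∑ c̄_i = 0` and `j` nonzero `c_i` correspond to `j`-element sets of indices. -/
def equivPowersetCard (n j : ℕ) :
    {T : TypeTuple n //
      (Finset.univ.filter (fun i => T.c i ≠ 0)).card = j ∧ ∑ i, T.cbar i = 0} ≃
      Finset.powersetCard j (Finset.univ : Finset (Fin (2 * n))) where
  toFun T := ⟨Finset.univ.filter (fun i => T.1.c i ≠ 0),
    Finset.mem_powersetCard.2 ⟨Finset.subset_univ _, T.2.1⟩⟩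
  invFun s := ⟨ofFinset s.1, by
    rw [filter_c_ofFinset]
    exact ⟨(Finset.mem_powersetCard.1 s.2).2, Finset.sum_eq_zero fun i _ => cbar_ofFinset _ i⟩⟩
  left_inv T := Subtype.ext (ofFinset_filter_c T.1 (by simpa using T.2.2))
  right_inv s := Subtype.ext (filter_c_ofFinset s.1)

end TypeTuple

/-- The number of type-(2n+1) tuples with exactly `j` nonzero `c_i` and
`∑ c̄_i = 0` equals `C(2n, j)`. -/
theorem count_type_tuples_sum_zero (n j : ℕ) (hn : 1 ≤ n) (hj : j ≤ 2 * n) :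
    Nat.card {T : TypeTuple n //
        (Finset.univ.filter (fun i => T.c i ≠ 0)).card = j ∧ ∑ i, T.cbar i = 0} =
      Nat.choose (2 * n) j := by
  rw [Nat.card_congr (TypeTuple.equivPowersetCard n j), Nat.card_eq_fintype_card,
    Fintype.card_coe, Finset.card_powersetCard, Finset.card_univ, Fintype.card_fin]
end

section
/- Fix natural numbers n ≥ 1 and k ≥ 0. The number of type-(2n+1) tuples (ε, c) satisfying c̄_1 + c̄_2 + ⋯ + c̄_{2n} = k (with no restriction on how many c_i vanish) is equal to 2^{2n} · C(2n+k−1, k). -/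
namespace TypeTuple

/-- The integer `ε_i · c_i` recovered from its sign bit (`true` for negative) and `c̄_i`. -/
def signedEntry (b : Bool) (m : ℕ) : ℤ :=
  if b then -(((m / 2 : ℕ) : ℤ) + 1) else (((m + 1) / 2 : ℕ) : ℤ)

/-- The sign bit of `ε_i · c_i`. -/
def signBit {n : ℕ} (T : TypeTuple n) (i : Fin (2 * n)) : Bool :=
  decide (T.eps i.castSucc * T.c i < 0)

variable {n : ℕ}

theorem c_eq (T : TypeTuple n) (i : Fin (2 * n)) :
    T.c i = T.eps i.castSucc * signedEntry (T.signBit i) (T.cbar i) := by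
  have h := T.norm i
  simp only [signedEntry, signBit, cbar, psi, psiBar, decide_eq_true_eq]
  rcases T.eps_pm i.castSucc with h₁ | h₁ <;> rcases T.eps_pm i.succ with h₂ | h₂ <;>
    rw [h₁, h₂] at h <;> simp only [h₁, h₂] <;> split_ifs <;> omega

theorem eps_succ (T : TypeTuple n) (i : Fin (2 * n)) :
    T.eps i.succ = T.eps i.castSucc * (-1) ^ T.cbar i := by
  have h := T.norm i
  have key : T.cbar i % 2 = 0 ∧ T.eps i.succ = T.eps i.castSucc ∨
      T.cbar i % 2 = 1 ∧ T.eps i.succ = -T.eps i.castSucc := by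
    unfold cbar psi psiBar
    rcases T.eps_pm i.castSucc with h₁ | h₁ <;> rcases T.eps_pm i.succ with h₂ | h₂ <;>
      rw [h₁, h₂] at h <;> rw [h₁, h₂] <;> split_ifs <;> omega
  rcases key with ⟨hm, h⟩ | ⟨hm, h⟩
  · rw [(Nat.even_iff.2 hm).neg_one_pow, h, mul_one]
  · rw [(Nat.odd_iff.2 hm).neg_one_pow, h, mul_neg_one]

theorem eps_eq_partialProd (T : TypeTuple n) :
    T.eps = Fin.partialProd fun i => (-1) ^ T.cbar i := by
  funext i
  induction i using Fin.induction with
  | zero => rw [T.eps_zero, Fin.partialProd_zero]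
  | succ i ih => rw [T.eps_succ, Fin.partialProd_succ, ih]

theorem ext_signBit_cbar {T U : TypeTuple n} (hb : T.signBit = U.signBit)
    (hm : T.cbar = U.cbar) : T = U := by
  have he : T.eps = U.eps := by rw [eps_eq_partialProd, eps_eq_partialProd, hm]
  have hc : T.c = U.c := by
    funext i
    rw [T.c_eq, U.c_eq, he, hb, hm]
  cases T
  cases U
  simp_all

theorem partialProd_neg_one_pow {N : ℕ} (m : Fin N → ℕ) (i : Fin (N + 1)) :
    Fin.partialProd (fun i => (-1 : ℤ) ^ m i) i = 1 ∨
      Fin.partialProd (fun i => (-1 : ℤ) ^ m i) i = -1 := by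
  induction i using Fin.induction with
  | zero => exact .inl (Fin.partialProd_zero _)
  | succ i ih =>
    rw [Fin.partialProd_succ]
    rcases ih with ih | ih <;> rcases neg_one_pow_eq_or ℤ (m i) with h | h <;> simp [ih, h]

/-- The tuple with prescribed sign bits and prescribed values `c̄_i`. -/
def ofSignBitCbar (b : Fin (2 * n) → Bool) (m : Fin (2 * n) → ℕ) : TypeTuple n where
  eps := Fin.partialProd fun i => (-1) ^ m i
  c i := Fin.partialProd (fun i => (-1 : ℤ) ^ m i) i.castSucc * signedEntry (b i) (m i)
  eps_pm := partialProd_neg_one_pow m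
  eps_zero := Fin.partialProd_zero _
  norm i h := by
    have hm : m i = 0 := by
      rcases partialProd_neg_one_pow m i.castSucc with h₁ | h₁ <;>
        rw [h₁] at h <;> unfold signedEntry at h <;> split_ifs at h <;> omega
    rw [Fin.partialProd_succ, hm, pow_zero, mul_one]

theorem c_ofSignBitCbar (b : Fin (2 * n) → Bool) (m : Fin (2 * n) → ℕ) (i : Fin (2 * n)) :
    (ofSignBitCbar b m).c i =
      (ofSignBitCbar b m).eps i.castSucc * signedEntry (b i) (m i) :=
  rfl

theorem eps_succ_ofSignBitCbar (b : Fin (2 * n) → Bool) (m : Fin (2 * n) → ℕ)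
    (i : Fin (2 * n)) :
    (ofSignBitCbar b m).eps i.succ = (ofSignBitCbar b m).eps i.castSucc * (-1) ^ m i :=
  Fin.partialProd_succ _ i

theorem signBit_ofSignBitCbar (b : Fin (2 * n) → Bool) (m : Fin (2 * n) → ℕ) :
    (ofSignBitCbar b m).signBit = b := by
  funext i
  unfold signBit
  rw [c_ofSignBitCbar]
  rcases (ofSignBitCbar b m).eps_pm i.castSucc with h | h <;> rw [h] <;>
    cases b i <;> simp [signedEntry] <;> omega

theorem cbar_ofSignBitCbar (b : Fin (2 * n) → Bool) (m : Fin (2 * n) → ℕ) :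
    (ofSignBitCbar b m).cbar = m := by
  funext i
  unfold cbar psi psiBar
  rw [c_ofSignBitCbar, eps_succ_ofSignBitCbar]
  rcases (ofSignBitCbar b m).eps_pm i.castSucc with h | h <;> rw [h] <;>
    rcases (m i).even_or_odd with hm | hm <;> rw [hm.neg_one_pow] <;>
    obtain ⟨j, hm⟩ := hm <;>
    cases b i <;> simp only [signedEntry, if_true, Bool.false_eq_true, if_false] <;>
    split_ifs <;> omega

/-- A type-`(2n+1)` tuple amounts to its sign bits together with the values `c̄_i`. -/
def equivSignBitCbar (n : ℕ) :
    TypeTuple n ≃ (Fin (2 * n) → Bool) × (Fin (2 * n) → ℕ) where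
  toFun T := (T.signBit, T.cbar)
  invFun p := ofSignBitCbar p.1 p.2
  left_inv _ := ext_signBit_cbar (signBit_ofSignBitCbar _ _) (cbar_ofSignBitCbar _ _)
  right_inv _ := Prod.ext (signBit_ofSignBitCbar _ _) (cbar_ofSignBitCbar _ _)

end TypeTuple

/-- The number of type-(2n+1) tuples with `∑ c̄_i = k` equals
`2^{2n} · C(2n+k−1, k)`. -/
theorem count_type_tuples_by_sum (n k : ℕ) (hn : 1 ≤ n) :
    Nat.card {T : TypeTuple n // ∑ i, T.cbar i = k} =
      2 ^ (2 * n) * Nat.choose (2 * n + k - 1) k := by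
  rw [Nat.card_congr <| ((TypeTuple.equivSignBitCbar n).subtypeEquiv
      (q := fun p => True ∧ ∑ i, p.2 i = k) fun T => by
        simp [TypeTuple.equivSignBitCbar]).trans <|
    (Equiv.subtypeProdEquivProd (p := fun _ => True)
      (q := fun m : Fin (2 * n) → ℕ => ∑ i, m i = k)).trans <|
    (Equiv.Set.univ _).prodCongr (Sym.equivNatSumOfFintype _ k).symm]
  simp [Sym.card_sym_eq_choose]
end

section
/- Fix natural numbers n ≥ 1, t with 1 ≤ t ≤ n, and an even number k ≥ 2. The number of symmetric type-(2n+1) tuples (ε, c) such that exactly 2t of the entries c_1, …, c_{2n} are nonzero and c̄_1 + c̄_2 + ⋯ + c̄_{2n} = k is equal to C(n, t) · ( ∑_{p=1}^{min(k/2, t)} 2^p · C(t, p) · C(k/2 − 1, p − 1) ). -/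
open Finset in
/-- A word in `Option X` with `t` letters different from `none` amounts to the set of positions of
these letters together with the word of length `t` in `X` that they spell. -/
theorem nonempty_equiv_powersetCard_prod {ι X : Type*} [Fintype ι] [DecidableEq ι]
    [DecidableEq X] (w : X → ℕ) (t m : ℕ) :
    Nonempty ({f : ι → Option X // #{i | f i ≠ none} = t ∧ ∑ i, (f i).elim 0 w = m} ≃
      powersetCard t (univ : Finset ι) × {g : Fin t → X // ∑ i, w (g i) = m}) := by
  have hcard (T : powersetCard t (univ : Finset ι)) : Fintype.card T.1 = t := by
    simpa using (mem_powersetCard.1 T.2).2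
  let e (T : powersetCard t (univ : Finset ι)) : T.1 ≃ Fin t :=
    Fintype.equivFinOfCardEq (hcard T)
  let F (T : powersetCard t (univ : Finset ι)) (g : Fin t → X) (i : ι) : Option X :=
    if h : i ∈ T.1 then some (g (e T ⟨i, h⟩)) else none
  have hsupp T g : ({i | F T g i ≠ none} : Finset ι) = T.1 := by
    ext i
    by_cases h : i ∈ T.1 <;> simp [F, h]
  have hsum T g : ∑ i, (F T g i).elim 0 w = ∑ j, w (g j) := by
    rw [← sum_subset (subset_univ T.1) (fun i _ hi => by simp [F, hi]), ← sum_coe_sort,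
      ← (e T).sum_comp]
    exact sum_congr rfl fun i _ => by simp [F]
  refine ⟨(Equiv.ofBijective (fun p => ⟨F p.1 p.2.1, (congrArg card (hsupp _ _)).trans
    (mem_powersetCard.1 p.1.2).2, (hsum _ _).trans p.2.2⟩) ⟨?_, ?_⟩).symm⟩
  · rintro ⟨T, g, hg⟩ ⟨T', g', hg'⟩ h
    have h : F T g = F T' g' := congrArg Subtype.val h
    obtain rfl : T = T' := Subtype.ext (by rw [← hsupp T g, h, hsupp])
    obtain rfl : g = g' := by
      ext1 j
      simpa [F] using congrFun h ((e T).symm j)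
    rfl
  · rintro ⟨f, hf, hm⟩
    let T : powersetCard t (univ : Finset ι) :=
      ⟨({i | f i ≠ none} : Finset ι), mem_powersetCard.2 ⟨subset_univ _, hf⟩⟩
    have hT (i : T.1) : (f i).isSome := by
      simpa [Option.isSome_iff_ne_none] using (mem_filter.1 i.2).2
    let g (j : Fin t) : X := (f ((e T).symm j)).get (hT _)
    have hF : F T g = f := by
      ext1 i
      by_cases h : f i = none
      · simp [F, T, h]
      · have h' : i ∈ T.1 := by simp [T, h]
        simp [F, h', g]
    exact ⟨⟨T, g, by rw [← hsum T g, hF, hm]⟩, Subtype.ext hF⟩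

/-- Sequences of `p` nonzero integers of absolute values `(g i).2 + 1` summing to `m` are given by
their signs and a multiset of size `m - p`. -/
theorem nonempty_equiv_signs_prod_sym {p m : ℕ} (hp : p ≤ m) :
    Nonempty ({g : Fin p → Bool × ℕ // ∑ i, ((g i).2 + 1) = m} ≃
      (Fin p → Bool) × Sym (Fin p) (m - p)) := by
  refine ⟨((((Equiv.arrowProdEquivProdArrow (Fin p) (fun _ => Bool) (fun _ => ℕ)).subtypeEquiv
    (q := fun x => True ∧ ∑ i, x.2 i = m - p) fun g => ?_)).trans
    ((Equiv.subtypeProdEquivProd (p := fun _ => True)).trans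
      ((Equiv.subtypeUnivEquiv fun _ => trivial).prodCongr
        (Sym.equivNatSumOfFintype (Fin p) (m - p)).symm)))⟩
  simp [Finset.sum_add_distrib, Equiv.arrowProdEquivProdArrow]
  omega

theorem isEmpty_signed_composition {p m : ℕ} (hp : m < p) :
    IsEmpty {g : Fin p → Bool × ℕ // ∑ i, ((g i).2 + 1) = m} := by
  refine ⟨fun g => ?_⟩
  have h := g.2
  simp only [Finset.sum_add_distrib, Finset.sum_const, Finset.card_univ, Fintype.card_fin,
    smul_eq_mul, mul_one] at h
  omega

instance finite_signed_composition (p m : ℕ) :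
    Finite {g : Fin p → Bool × ℕ // ∑ i, ((g i).2 + 1) = m} := by
  rcases le_or_gt p m with hp | hp
  · exact Finite.of_equiv _ (nonempty_equiv_signs_prod_sym hp).some.symm
  · have := isEmpty_signed_composition hp
    infer_instance

theorem card_signed_composition (p m : ℕ) (hm : 1 ≤ m) :
    Nat.card {g : Fin p → Bool × ℕ // ∑ i, ((g i).2 + 1) = m} =
      if p = 0 then 0 else 2 ^ p * (m - 1).choose (p - 1) := by
  rcases le_or_gt p m with hp | hp
  · rw [Nat.card_congr (nonempty_equiv_signs_prod_sym hp).some, Nat.card_prod,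
      Nat.card_eq_fintype_card, Nat.card_eq_fintype_card, Sym.card_sym_eq_choose]
    simp only [Fintype.card_pi, Fintype.card_bool, Finset.prod_const, Finset.card_univ,
      Fintype.card_fin]
    split_ifs with h
    · subst h
      simp [Nat.choose_eq_zero_of_lt (show m - 1 < m by omega)]
    · rw [Nat.add_sub_cancel' hp,
        Nat.choose_symm_of_eq_add (show m - 1 = (m - p) + (p - 1) by omega)]
  · have := isEmpty_signed_composition hp
    rw [Nat.card_of_isEmpty, Nat.choose_eq_zero_of_lt (by omega)]
    simp

/-- The number of lattice points of `ℓ¹`-norm `m` in dimension `t`. -/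
theorem card_l1_sphere (t m : ℕ) (hm : 1 ≤ m) :
    Nat.card {g : Fin t → Option (Bool × ℕ) // ∑ i, (g i).elim 0 (fun x => x.2 + 1) = m} =
      ∑ p ∈ Finset.Icc 1 (min m t), 2 ^ p * t.choose p * (m - 1).choose (p - 1) := by
  classical
  let S (p : ℕ) := {g : Fin t → Option (Bool × ℕ) //
    (Finset.univ.filter fun i => g i ≠ none).card = p ∧
      ∑ i, (g i).elim 0 (fun x => x.2 + 1) = m}
  have e (p : ℕ) := (nonempty_equiv_powersetCard_prod (ι := Fin t)
    (fun x : Bool × ℕ => x.2 + 1) p m).some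
  have hfin (p : ℕ) : Finite (S p) := Finite.of_equiv _ (e p).symm
  have hS (p : ℕ) : Nat.card (S p) =
      if p = 0 then 0 else 2 ^ p * t.choose p * (m - 1).choose (p - 1) := by
    rw [Nat.card_congr (e p), Nat.card_prod, card_signed_composition p m hm]
    simp only [Nat.card_eq_fintype_card, Fintype.card_coe, Finset.card_powersetCard,
      Finset.card_univ, Fintype.card_fin]
    split_ifs <;> ring
  let E : {g : Fin t → Option (Bool × ℕ) // ∑ i, (g i).elim 0 (fun x => x.2 + 1) = m} ≃
      Σ p : Fin (t + 1), S p :=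
    { toFun g := ⟨⟨(Finset.univ.filter fun i => g.1 i ≠ none).card,
        Nat.lt_succ_of_le ((Finset.card_le_univ _).trans_eq (Fintype.card_fin t))⟩,
          g.1, rfl, g.2⟩
      invFun x := ⟨x.2.1, x.2.2.2⟩
      left_inv _ := rfl
      right_inv := by
        rintro ⟨⟨p, hp⟩, g, hg, hm⟩
        have hp' : p = (Finset.univ.filter fun i => g i ≠ none).card := hg.symm
        subst hp'
        rfl }
  rw [Nat.card_congr E, Nat.card_sigma]
  simp only [hS]
  rw [Fin.sum_univ_eq_sum_range
    (fun p => if p = 0 then 0 else 2 ^ p * t.choose p * (m - 1).choose (p - 1))]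
  symm
  apply Finset.sum_subset_zero_on_sdiff
  · intro p hp
    simp only [Finset.mem_Icc, Finset.mem_range] at hp ⊢
    omega
  · intro p hp
    simp only [Finset.mem_sdiff, Finset.mem_Icc, Finset.mem_range] at hp
    split_ifs with h
    · rfl
    · rw [Nat.choose_eq_zero_of_lt (show m - 1 < p - 1 by omega), mul_zero]
  · intro p hp
    rw [if_neg]
    have := (Finset.mem_Icc.1 hp).1
    omega

/-- The possible values of `(ε_i c_i, ε_i ε_{i+1})`, listed by their weight `c̄_i`: `none` is the
step with `c_i = 0`, `some none` the one with `c_i ≠ 0` of weight `0`, and `some (some (b, j))` the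
two of weight `j + 1`, with `c_i` of sign `b` relative to `ε_i`. -/
def decodeStep : Option (Option (Bool × ℕ)) → ℤ × ℤ
  | none => (0, 1)
  | some none => (-1, 1)
  | some (some (true, j)) => ((j + 2) / 2, if j % 2 = 0 then -1 else 1)
  | some (some (false, j)) => (-((j + 1) / 2 + 1), if j % 2 = 0 then -1 else 1)

theorem decodeStep_snd (l : Option (Option (Bool × ℕ))) :
    (decodeStep l).2 = 1 ∨ (decodeStep l).2 = -1 := by
  rcases l with _ | _ | ⟨_ | _, j⟩ <;> grind [decodeStep]

theorem decodeStep_fst_eq_zero (l : Option (Option (Bool × ℕ))) :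
    (decodeStep l).1 = 0 ↔ l = none := by
  rcases l with _ | _ | ⟨_ | _, j⟩ <;> simp [decodeStep] <;> omega

theorem decodeStep_injective : Function.Injective decodeStep := by
  intro l l' h
  rcases l with _ | _ | ⟨_ | _, j⟩ <;> rcases l' with _ | _ | ⟨_ | _, j'⟩ <;>
    simp only [decodeStep, Prod.mk.injEq] at h <;> grind

theorem exists_decodeStep {x s : ℤ} (hs : s = 1 ∨ s = -1) (h : x = 0 → s = 1) :
    ∃ l, decodeStep l = (x, s) := by
  rcases lt_trichotomy x 0 with hx | rfl | hx
  · rcases hs with rfl | rfl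
    · rcases eq_or_ne x (-1) with rfl | hx'
      · exact ⟨some none, rfl⟩
      · refine ⟨some (some (false, (-2 * x - 3).toNat)), ?_⟩
        simp only [decodeStep, Prod.mk.injEq]
        grind
    · refine ⟨some (some (false, (-2 * x - 2).toNat)), ?_⟩
      simp only [decodeStep, Prod.mk.injEq]
      grind
  · exact ⟨none, by rw [h rfl, decodeStep]⟩
  · rcases hs with rfl | rfl
    · refine ⟨some (some (true, (2 * x - 1).toNat)), ?_⟩
      simp only [decodeStep, Prod.mk.injEq]
      grind
    · refine ⟨some (some (true, (2 * x - 2).toNat)), ?_⟩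
      simp only [decodeStep, Prod.mk.injEq]
      grind

theorem decodeStep_weight (l : Option (Option (Bool × ℕ))) :
    2 * (decodeStep l).1.natAbs - (if (decodeStep l).1 < 0 then 1 else 0) -
      (if (decodeStep l).1 * (decodeStep l).2 < 0 then 1 else 0) =
      l.elim 0 (fun o => o.elim 0 (fun x => x.2 + 1)) := by
  have hs := decodeStep_snd l
  rcases h : decodeStep l with ⟨x, s⟩
  rw [h] at hs
  change 2 * x.natAbs - (if x < 0 then 1 else 0) - (if x * s < 0 then 1 else 0) = _
  change s = 1 ∨ s = -1 at hs
  rcases l with _ | _ | ⟨_ | _, j⟩ <;> rw [decodeStep, Prod.mk.injEq] at h <;>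
    simp only [Option.elim] <;> obtain ⟨h1, h2⟩ := h <;> rcases hs with rfl | rfl <;>
    split_ifs at h2 ⊢ <;> omega

namespace TypeTuple

variable {n : ℕ}

/-- The signs `ε_i` determined by the successive quotients `ε_i ε_{i+1}`. -/
def signOf (f : Fin n → Option (Option (Bool × ℕ))) : ℕ → ℤ
  | 0 => 1
  | i + 1 => signOf f i * if h : i < n then (decodeStep (f ⟨i, h⟩)).2 else 1

/-- The entries `c_i` in the first half. -/
def entryOf (f : Fin n → Option (Option (Bool × ℕ))) (i : ℕ) : ℤ :=
  signOf f i * if h : i < n then (decodeStep (f ⟨i, h⟩)).1 else 0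

theorem signOf_pm (f : Fin n → Option (Option (Bool × ℕ))) (i : ℕ) :
    signOf f i = 1 ∨ signOf f i = -1 := by
  induction i with
  | zero => exact .inl rfl
  | succ i ih =>
    rw [signOf]
    split_ifs with h
    · rcases ih with ih | ih <;> rcases decodeStep_snd (f ⟨i, h⟩) with h | h <;> simp [ih, h]
    · simpa using ih

theorem signOf_succ (f : Fin n → Option (Option (Bool × ℕ))) {i : ℕ} (h : i < n) :
    signOf f (i + 1) = signOf f i * (decodeStep (f ⟨i, h⟩)).2 := by
  rw [signOf, dif_pos h]

theorem entryOf_of_lt (f : Fin n → Option (Option (Bool × ℕ))) {i : ℕ} (h : i < n) :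
    entryOf f i = signOf f i * (decodeStep (f ⟨i, h⟩)).1 := by
  rw [entryOf, dif_pos h]

theorem entryOf_eq_zero (f : Fin n → Option (Option (Bool × ℕ))) {i : ℕ} (h : i < n) :
    entryOf f i = 0 ↔ f ⟨i, h⟩ = none := by
  rw [entryOf_of_lt f h, ← decodeStep_fst_eq_zero]
  rcases signOf_pm f i with h | h <;> simp [h]

theorem signOf_succ_of_entryOf_eq_zero (f : Fin n → Option (Option (Bool × ℕ))) {i : ℕ}
    (h : i < n) (h0 : entryOf f i = 0) : signOf f i = signOf f (i + 1) := by
  rw [signOf_succ f h, (entryOf_eq_zero f h).1 h0]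
  simp [decodeStep]

/-- The symmetric tuple whose first half is given by the steps `f`. -/
def ofSteps (f : Fin n → Option (Option (Bool × ℕ))) : TypeTuple n where
  eps i := signOf f (min i (2 * n - i))
  c i := entryOf f (min i (2 * n - 1 - i))
  eps_pm i := signOf_pm f _
  eps_zero := by simp [signOf]
  norm i h := by
    have hi := i.2
    rcases lt_or_ge i.1 n with hin | hin
    · rw [min_eq_left (by omega)] at h
      simp only [Fin.val_castSucc, Fin.val_succ]
      rw [min_eq_left (by omega), min_eq_left (by omega)]
      exact signOf_succ_of_entryOf_eq_zero f hin h
    · rw [min_eq_right (by omega)] at h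
      simp only [Fin.val_castSucc, Fin.val_succ]
      rw [min_eq_right (by omega), min_eq_right (by omega),
        show 2 * n - i = 2 * n - 1 - i + 1 by omega,
        show 2 * n - (i + 1) = 2 * n - 1 - i by omega]
      exact (signOf_succ_of_entryOf_eq_zero f (by omega) h).symm

theorem eps_ofSteps (f : Fin n → Option (Option (Bool × ℕ))) {i : ℕ} (h : i ≤ n) :
    (ofSteps f).eps ⟨i, by omega⟩ = signOf f i :=
  congrArg (signOf f) (min_eq_left (by simp only; omega))

theorem c_ofSteps (f : Fin n → Option (Option (Bool × ℕ))) {i : ℕ} (h : i < n) :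
    (ofSteps f).c ⟨i, by omega⟩ = entryOf f i :=
  congrArg (entryOf f) (min_eq_left (by simp only; omega))

theorem symm_ofSteps (f : Fin n → Option (Option (Bool × ℕ))) : (ofSteps f).Symm := by
  refine ⟨fun i => congrArg (signOf f) ?_, fun i => congrArg (entryOf f) ?_⟩ <;>
  · have := i.2
    simp only [Fin.val_rev]
    omega

theorem ofSteps_injective : Function.Injective (ofSteps (n := n)) := by
  intro f g hfg
  have hs {i : ℕ} (h : i ≤ n) : signOf f i = signOf g i := by
    rw [← eps_ofSteps f h, ← eps_ofSteps g h, hfg]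
  have hc {i : ℕ} (h : i < n) : entryOf f i = entryOf g i := by
    rw [← c_ofSteps f h, ← c_ofSteps g h, hfg]
  ext1 ⟨i, hi⟩
  have h0 : signOf g i ≠ 0 := by rcases signOf_pm g i with h | h <;> simp [h]
  apply decodeStep_injective
  have h1 := hc hi
  have h2 := hs (show i + 1 ≤ n from hi)
  rw [entryOf_of_lt f hi, entryOf_of_lt g hi, hs hi.le] at h1
  rw [signOf_succ f hi, signOf_succ g hi, hs hi.le] at h2
  exact Prod.ext (mul_left_cancel₀ h0 h1) (mul_left_cancel₀ h0 h2)

theorem Symm.ext {S T : TypeTuple n} (hS : S.Symm) (hT : T.Symm)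
    (he : ∀ i : Fin (2 * n + 1), i.1 ≤ n → S.eps i = T.eps i)
    (hc : ∀ i : Fin (2 * n), i.1 < n → S.c i = T.c i) : S = T := by
  have he' : S.eps = T.eps := by
    ext1 i
    rcases le_or_gt i.1 n with h | h
    · exact he i h
    · rw [hS.1, hT.1, he]
      rw [Fin.val_rev]
      omega
  have hc' : S.c = T.c := by
    ext1 i
    rcases lt_or_ge i.1 n with h | h
    · exact hc i h
    · rw [hS.2, hT.2, hc]
      rw [Fin.val_rev]
      omega
  cases S
  cases T
  congr

theorem exists_ofSteps_eq {T : TypeTuple n} (hT : T.Symm) : ∃ f, ofSteps f = T := by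
  have hstep (i : Fin n) : ∃ l, decodeStep l =
      (T.eps ⟨i, by omega⟩ * T.c ⟨i, by omega⟩, T.eps ⟨i, by omega⟩ * T.eps ⟨i + 1, by omega⟩) := by
    have h1 := T.eps_pm ⟨i, by omega⟩
    have h2 := T.eps_pm ⟨i + 1, by omega⟩
    apply exists_decodeStep
    · rcases h1 with h1 | h1 <;> rcases h2 with h2 | h2 <;> simp [h1, h2]
    · intro h
      have h3 : T.eps ⟨i, by omega⟩ = T.eps ⟨i + 1, by omega⟩ := T.norm ⟨i, by omega⟩ <| by
        rcases h1 with h1 | h1 <;> simpa [h1] using h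
      rw [← h3]
      rcases h1 with h1 | h1 <;> simp [h1]
  choose f hf using hstep
  have hs (i : ℕ) (hi : i ≤ n) : signOf f i = T.eps ⟨i, by omega⟩ := by
    induction i with
    | zero => exact T.eps_zero.symm
    | succ i ih =>
      rw [signOf_succ f hi, ih (by omega), hf]
      rcases T.eps_pm ⟨i, by omega⟩ with h | h <;> simp [h]
  refine ⟨f, (symm_ofSteps f).ext hT (fun i hi => ?_) fun i hi => ?_⟩
  · exact (eps_ofSteps f hi).trans (hs i hi)
  · refine (c_ofSteps f hi).trans ?_
    rw [entryOf_of_lt f hi, hs i hi.le, hf]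
    rcases T.eps_pm ⟨i, by omega⟩ with h | h <;> simp [h]

/-- Symmetric tuples correspond to sequences of `n` steps. -/
noncomputable def stepsEquiv (n : ℕ) :
    (Fin n → Option (Option (Bool × ℕ))) ≃ {T : TypeTuple n // T.Symm} :=
  Equiv.ofBijective (fun f => ⟨ofSteps f, symm_ofSteps f⟩)
    ⟨fun _ _ h => ofSteps_injective (congrArg Subtype.val h),
      fun T => (exists_ofSteps_eq T.2).imp fun _ h => Subtype.ext h⟩

theorem cbar_ofSteps (f : Fin n → Option (Option (Bool × ℕ))) (i : Fin n) :
    (ofSteps f).cbar ⟨i, by omega⟩ =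
      (f i).elim 0 (fun o => o.elim 0 (fun x => x.2 + 1)) := by
  have hc := c_ofSteps f i.2
  have he : (ofSteps f).eps (Fin.castSucc ⟨i, by omega⟩) = signOf f i := eps_ofSteps f i.2.le
  have he' : (ofSteps f).eps (Fin.succ ⟨i, by omega⟩) = signOf f (i + 1) := eps_ofSteps f i.2
  rw [cbar, psi, psiBar, hc, he, he', ← decodeStep_weight, signOf_succ f i.2, entryOf_of_lt f i.2]
  rcases signOf_pm f i with h | h <;> simp [h]

theorem Symm.cbar_rev {T : TypeTuple n} (hT : T.Symm) (i : Fin (2 * n)) :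
    T.cbar i.rev = T.cbar i := by
  have h : T.psi i.rev = T.psiBar i := by
    rw [psi, psiBar, hT.1, ← hT.2, ← Fin.rev_succ, Fin.rev_rev, mul_comm]
  have h' : T.psiBar i.rev = T.psi i := by
    rw [psi, psiBar, hT.1, ← hT.2, ← Fin.rev_castSucc, Fin.rev_rev, mul_comm]
  rw [cbar, cbar, h, h', ← hT.2]
  omega

end TypeTuple

theorem sum_eq_two_mul_of_rev {n : ℕ} (g : Fin (2 * n) → ℕ) (hg : ∀ i, g i.rev = g i) :
    ∑ i, g i = 2 * ∑ i : Fin n, g ⟨i, by omega⟩ := by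
  let G (i : ℕ) : ℕ := if h : i < 2 * n then g ⟨i, h⟩ else 0
  have h1 (i : Fin (2 * n)) : g i = G i := by simp [G]
  have h2 (i : Fin n) : g ⟨i, by omega⟩ = G i := h1 _
  simp only [h2]
  simp only [h1]
  rw [Fin.sum_univ_eq_sum_range, Fin.sum_univ_eq_sum_range, two_mul n, Finset.sum_range_add,
    two_mul, ← Finset.sum_range_reflect (fun i => G (n + i))]
  congr 1
  refine Finset.sum_congr rfl fun i hi => ?_
  have hi := Finset.mem_range.1 hi
  rw [← h1 ⟨i, by omega⟩, ← hg, h1, Fin.val_rev]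
  congr 1
  simp only
  omega

namespace TypeTuple

theorem sum_cbar_ofSteps {n : ℕ} (f : Fin n → Option (Option (Bool × ℕ))) :
    ∑ i, (ofSteps f).cbar i =
      2 * ∑ i, (f i).elim 0 (fun o => o.elim 0 (fun x => x.2 + 1)) := by
  rw [sum_eq_two_mul_of_rev _ (symm_ofSteps f).cbar_rev]
  simp only [cbar_ofSteps]

theorem card_support_ofSteps {n : ℕ} (f : Fin n → Option (Option (Bool × ℕ))) :
    (Finset.univ.filter fun i => (ofSteps f).c i ≠ 0).card =
      2 * (Finset.univ.filter fun i => f i ≠ none).card := by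
  rw [Finset.card_filter, Finset.card_filter,
    sum_eq_two_mul_of_rev _ fun i => by rw [← (symm_ofSteps f).2]]
  simp only [ne_eq, c_ofSteps f (Fin.is_lt _), entryOf_eq_zero f (Fin.is_lt _), Fin.eta]

end TypeTuple

/-- For `1 ≤ t ≤ n` and even `k ≥ 2`, the number of symmetric type-(2n+1) tuples
with exactly `2t` nonzero `c_i` and `∑ c̄_i = k` equals
`C(n, t) · ∑_{p=1}^{min(k/2, t)} 2^p C(t, p) C(k/2 − 1, p − 1)`. -/
theorem count_symmetric_type_tuples_by_support_and_sum (n t k : ℕ) (hn : 1 ≤ n)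
    (ht1 : 1 ≤ t) (ht2 : t ≤ n) (hk : 2 ≤ k) (hke : Even k) :
    Nat.card {T : TypeTuple n //
        T.Symm ∧ (Finset.univ.filter (fun i => T.c i ≠ 0)).card = 2 * t ∧
        ∑ i, T.cbar i = k} =
      Nat.choose n t *
        ∑ p ∈ Finset.Icc 1 (min (k / 2) t),
          2 ^ p * Nat.choose t p * Nat.choose (k / 2 - 1) (p - 1) := by
  classical
  obtain ⟨m, rfl⟩ := hke
  rw [← two_mul] at hk ⊢
  rw [Nat.mul_div_cancel_left m two_pos]
  let e : {f : Fin n → Option (Option (Bool × ℕ)) //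
      (Finset.univ.filter fun i => f i ≠ none).card = t ∧
        ∑ i, (f i).elim 0 (fun o => o.elim 0 (fun x => x.2 + 1)) = m} ≃
      {T : TypeTuple n // T.Symm ∧ (Finset.univ.filter (fun i => T.c i ≠ 0)).card = 2 * t ∧
        ∑ i, T.cbar i = 2 * m} :=
    ((TypeTuple.stepsEquiv n).subtypeEquiv (q := fun T =>
      (Finset.univ.filter (fun i => T.1.c i ≠ 0)).card = 2 * t ∧ ∑ i, T.1.cbar i = 2 * m)
      fun f => by
        change _ ↔ (Finset.univ.filter fun i => (TypeTuple.ofSteps f).c i ≠ 0).card = 2 * t ∧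
          ∑ i, (TypeTuple.ofSteps f).cbar i = 2 * m
        rw [TypeTuple.card_support_ofSteps, TypeTuple.sum_cbar_ofSteps,
          Nat.mul_right_inj two_ne_zero, Nat.mul_right_inj two_ne_zero]).trans
    (Equiv.subtypeSubtypeEquivSubtypeInter _ fun T : TypeTuple n =>
      (Finset.univ.filter (fun i => T.c i ≠ 0)).card = 2 * t ∧ ∑ i, T.cbar i = 2 * m)
  rw [← Nat.card_congr e, Nat.card_congr (nonempty_equiv_powersetCard_prod _ t m).some,
    Nat.card_prod, card_l1_sphere t m (by omega)]
  simp
end
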